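/- For a separable (classically correlated) state ω = Σ_n p(n) ρ_n ⊗ σ_n on ℂ^m ⊗ ℂ^n, where p is a probability distribution and ρ_n, σ_n are density matrices, the mutual information satisfies I(ω) ≤ S(σ) where σ = Σ_n p(n) σ_n is the second marginal. -/

import Mathlib

open Matrix Kronecker ComplexOrder

/-- Matrix logarithm via functional calculus on the support
(zero eigenvalues are sent to zero since `Real.log 0 = 0`). -/
noncomputable def matLog {n : Type*} [Fintype n] [DecidableEq n] (τ : Matrix n n ℂ) :
    Matrix n n ℂ :=
  if h : τ.IsHermitian then
    (h.eigenvectorUnitary : Matrix n n ℂ) *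
      Matrix.diagonal (fun i => (Real.log (h.eigenvalues i) : ℂ)) *
      star (h.eigenvectorUnitary : Matrix n n ℂ)
  else 0

/-- von Neumann entropy `S(τ) = -Tr (τ log τ)`. -/
noncomputable def vnEntropy {n : Type*} [Fintype n] [DecidableEq n] (τ : Matrix n n ℂ) : ℝ :=
  -(τ * matLog τ).trace.re

/-- Quantum relative entropy `R(ω:φ) = Tr (ω (log ω - log φ))` (logs on supports). -/
noncomputable def relEntropy {n : Type*} [Fintype n] [DecidableEq n]
    (ω φ : Matrix n n ℂ) : ℝ :=
  ((ω * (matLog ω - matLog φ)).trace).re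

/-- A density matrix: positive semidefinite with unit trace. -/
def IsDensity {n : Type*} [Fintype n] (τ : Matrix n n ℂ) : Prop :=
  τ.PosSemidef ∧ τ.trace = 1

/-- Partial trace over the second tensor factor. -/
noncomputable def ptrace2 {m n : Type*} [Fintype n]
    (ω : Matrix (m × n) (m × n) ℂ) : Matrix m m ℂ :=
  fun i j => ∑ k : n, ω (i, k) (j, k)

/-- Partial trace over the first tensor factor. -/
noncomputable def ptrace1 {m n : Type*} [Fintype m]
    (ω : Matrix (m × n) (m × n) ℂ) : Matrix n n ℂ :=
  fun k l => ∑ i : m, ω (i, k) (i, l)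

/-- Quantum mutual information `I(ω) = R(ω : ρ ⊗ σ)` of a bipartite state. -/
noncomputable def mutualInfo {m n : Type*} [Fintype m] [Fintype n] [DecidableEq m] [DecidableEq n]
    (ω : Matrix (m × n) (m × n) ℂ) : ℝ :=
  relEntropy ω (ptrace2 ω ⊗ₖ ptrace1 ω)

open Filter Topology

open scoped MatrixOrder Matrix.Norms.L2Operator

theorem ptrace2_isHermitian {ι κ : Type*} [Fintype κ] {ω : Matrix (ι × κ) (ι × κ) ℂ}
    (h : ω.IsHermitian) :
    (ptrace2 ω).IsHermitian := by
  ext i j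
  simp only [ptrace2, conjTranspose_apply, star_sum]
  exact Finset.sum_congr rfl fun k _ => h.apply _ _

theorem ptrace1_isHermitian {ι κ : Type*} [Fintype ι] {ω : Matrix (ι × κ) (ι × κ) ℂ}
    (h : ω.IsHermitian) :
    (ptrace1 ω).IsHermitian := by
  ext i j
  simp only [ptrace1, conjTranspose_apply, star_sum]
  exact Finset.sum_congr rfl fun k _ => h.apply _ _

theorem trace_mul_kronecker_one {ι κ : Type*} [Fintype ι] [Fintype κ] [DecidableEq κ]
    (ω : Matrix (ι × κ) (ι × κ) ℂ) (A : Matrix ι ι ℂ) :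
    (ω * (A ⊗ₖ (1 : Matrix κ κ ℂ))).trace = (ptrace2 ω * A).trace := by
  simp only [trace, diag_apply, mul_apply, kronecker_apply, ptrace2, Fintype.sum_prod_type,
    one_apply, mul_ite, mul_one, mul_zero, Finset.sum_ite_eq', Finset.mem_univ, if_true,
    Finset.sum_mul]
  exact Finset.sum_congr rfl fun i _ => Finset.sum_comm

theorem trace_mul_one_kronecker {ι κ : Type*} [Fintype ι] [Fintype κ] [DecidableEq ι]
    (ω : Matrix (ι × κ) (ι × κ) ℂ) (B : Matrix κ κ ℂ) :
    (ω * ((1 : Matrix ι ι ℂ) ⊗ₖ B)).trace = (ptrace1 ω * B).trace := by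
  simp only [trace, diag_apply, mul_apply, kronecker_apply, ptrace1, Fintype.sum_prod_type_right,
    one_apply, ite_mul, mul_ite, one_mul, zero_mul, mul_zero, Finset.sum_ite_eq', Finset.mem_univ,
    if_true, Finset.sum_mul]
  exact Finset.sum_congr rfl fun i _ => Finset.sum_comm

theorem ptrace2_sum_smul_kronecker {ι κ : Type*} [Fintype κ] {k : ℕ}
    (c : Fin k → ℂ) (A : Fin k → Matrix ι ι ℂ)
    (B : Fin k → Matrix κ κ ℂ) (hB : ∀ i, (B i).trace = 1) :
    ptrace2 (∑ i, c i • (A i ⊗ₖ B i)) = ∑ i, c i • A i := by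
  ext a b
  simp only [ptrace2, Matrix.sum_apply, Matrix.smul_apply, kronecker_apply, smul_eq_mul]
  rw [Finset.sum_comm]
  refine Finset.sum_congr rfl fun i _ => ?_
  rw [← Finset.mul_sum, ← Finset.mul_sum]
  have := hB i
  simp only [trace, diag_apply] at this
  rw [this, mul_one]

theorem ptrace1_sum_smul_kronecker {ι κ : Type*} [Fintype ι] {k : ℕ}
    (c : Fin k → ℂ) (A : Fin k → Matrix ι ι ℂ)
    (B : Fin k → Matrix κ κ ℂ) (hA : ∀ i, (A i).trace = 1) :
    ptrace1 (∑ i, c i • (A i ⊗ₖ B i)) = ∑ i, c i • B i := by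
  ext a b
  simp only [ptrace1, Matrix.sum_apply, Matrix.smul_apply, kronecker_apply, smul_eq_mul]
  rw [Finset.sum_comm]
  refine Finset.sum_congr rfl fun i _ => ?_
  rw [← Finset.mul_sum, ← Finset.sum_mul]
  have := hA i
  simp only [trace, diag_apply] at this
  rw [this, one_mul]

theorem sum_mul_log_mul_of_marginals {ι κ : Type*} [Fintype ι] [Fintype κ] {w : ι × κ → ℝ}
    {r : ι → ℝ} {s : κ → ℝ} (hw : ∀ x, 0 ≤ w x)
    (hleft : ∀ f : ι → ℝ, ∑ x, w x * f x.1 = ∑ i, r i * f i)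
    (hright : ∀ f : κ → ℝ, ∑ x, w x * f x.2 = ∑ j, s j * f j) :
    ∑ x, w x * Real.log (r x.1 * s x.2) =
      ∑ i, r i * Real.log (r i) + ∑ j, s j * Real.log (s j) := by
  classical
  have hr0 (x : ι × κ) (hx : r x.1 = 0) : w x = 0 := by
    have hsum := hleft (fun i => if r i = 0 then 1 else 0)
    rw [Finset.sum_eq_zero (s := Finset.univ) (f := fun i => r i * if r i = 0 then 1 else 0)
      (by simp +contextual)] at hsum
    have hz := (Finset.sum_eq_zero_iff_of_nonneg
      fun y _ => mul_nonneg (hw y) (by split_ifs <;> norm_num)).mp hsum x (Finset.mem_univ x)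
    simpa [hx] using hz
  have hs0 (x : ι × κ) (hx : s x.2 = 0) : w x = 0 := by
    have hsum := hright (fun j => if s j = 0 then 1 else 0)
    rw [Finset.sum_eq_zero (s := Finset.univ) (f := fun j => s j * if s j = 0 then 1 else 0)
      (by simp +contextual)] at hsum
    have hz := (Finset.sum_eq_zero_iff_of_nonneg
      fun y _ => mul_nonneg (hw y) (by split_ifs <;> norm_num)).mp hsum x (Finset.mem_univ x)
    simpa [hx] using hz
  rw [← hleft, ← hright, ← Finset.sum_add_distrib]
  refine Finset.sum_congr rfl fun x _ => ?_
  by_cases hrx : r x.1 = 0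
  · simp [hr0 x hrx]
  by_cases hsx : s x.2 = 0
  · simp [hs0 x hsx]
  rw [Real.log_mul hrx hsx, mul_add]

section

variable {ι κ : Type*} [Fintype ι] [DecidableEq ι] [Fintype κ] [DecidableEq κ]

theorem isHermitian_unitary_conj_diagonal (W : unitaryGroup ι ℂ) (d : ι → ℝ) :
    ((W : Matrix ι ι ℂ) * diagonal (fun i => (d i : ℂ)) * star (W : Matrix ι ι ℂ)).IsHermitian := by
  refine isHermitian_mul_mul_conjTranspose _ ?_
  simp [IsHermitian, diagonal_conjTranspose, Pi.star_def]

theorem Matrix.IsHermitian.eq_unitary_conj_diagonal {τ : Matrix ι ι ℂ} (h : τ.IsHermitian) :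
    τ = (h.eigenvectorUnitary : Matrix ι ι ℂ) * diagonal (fun i => (h.eigenvalues i : ℂ)) *
      star (h.eigenvectorUnitary : Matrix ι ι ℂ) :=
  h.spectral_theorem

theorem matLog_unitary_conj_diagonal (W : unitaryGroup ι ℂ) (d : ι → ℝ) :
    matLog ((W : Matrix ι ι ℂ) * diagonal (fun i => (d i : ℂ)) * star (W : Matrix ι ι ℂ)) =
      (W : Matrix ι ι ℂ) * diagonal (fun i => (Real.log (d i) : ℂ)) *
        star (W : Matrix ι ι ℂ) := by
  have h := isHermitian_unitary_conj_diagonal W d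
  rw [matLog, dif_pos h]
  have hspec := h.eq_unitary_conj_diagonal
  generalize h.eigenvectorUnitary = U at hspec ⊢
  generalize h.eigenvalues = e at hspec ⊢
  have hU : star (U : Matrix ι ι ℂ) * U = 1 := Unitary.coe_star_mul_self U
  have hU' : (U : Matrix ι ι ℂ) * star (U : Matrix ι ι ℂ) = 1 := Unitary.coe_mul_star_self U
  have hW : star (W : Matrix ι ι ℂ) * W = 1 := Unitary.coe_star_mul_self W
  have hW' : (W : Matrix ι ι ℂ) * star (W : Matrix ι ι ℂ) = 1 := Unitary.coe_mul_star_self W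
  generalize (U : Matrix ι ι ℂ) = U at *
  generalize (W : Matrix ι ι ℂ) = W at *
  have hX : (star U * W) * diagonal (fun i => (d i : ℂ)) =
      diagonal (fun i => (e i : ℂ)) * (star U * W) := by
    calc _ = star U * (W * diagonal (fun i => (d i : ℂ)) * star W) * W := by
            simp only [Matrix.mul_assoc, hW, Matrix.mul_one]
      _ = (star U * U) * diagonal (fun i => (e i : ℂ)) * (star U * W) := by
            rw [hspec]; simp only [Matrix.mul_assoc]
      _ = _ := by rw [hU, Matrix.one_mul]
  have hL : (star U * W) * diagonal (fun i => (Real.log (d i) : ℂ)) =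
      diagonal (fun i => (Real.log (e i) : ℂ)) * (star U * W) := by
    ext i j
    have hij := congr_fun (congr_fun hX i) j
    rw [mul_diagonal, diagonal_mul] at hij ⊢
    by_cases h0 : (star U * W) i j = 0
    · simp [h0]
    · have hde : (d j : ℂ) = e i := mul_left_cancel₀ h0 (hij.trans (mul_comm _ _))
      rw [Complex.ofReal_inj.mp hde, mul_comm]
  calc _ = U * (diagonal (fun i => (Real.log (e i) : ℂ)) * (star U * W)) * star W := by
          simp only [Matrix.mul_assoc, hW', Matrix.mul_one]
    _ = (U * star U) * W * diagonal (fun i => (Real.log (d i) : ℂ)) * star W := by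
          rw [← hL]; simp only [Matrix.mul_assoc]
    _ = _ := by rw [hU', Matrix.one_mul]

theorem matLog_eq_cfcLog {τ : Matrix ι ι ℂ} (h : τ.IsHermitian) : matLog τ = CFC.log τ := by
  rw [matLog, dif_pos h, CFC.log, h.cfc_eq]
  rfl

theorem matLog_add_smul_one {τ : Matrix ι ι ℂ} (h : τ.IsHermitian) (ε : ℝ) :
    matLog (τ + (ε : ℂ) • 1) = (h.eigenvectorUnitary : Matrix ι ι ℂ) *
      diagonal (fun i => (Real.log (h.eigenvalues i + ε) : ℂ)) *
      star (h.eigenvectorUnitary : Matrix ι ι ℂ) := by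
  rw [← matLog_unitary_conj_diagonal]
  congr 1
  conv_lhs => rw [h.eq_unitary_conj_diagonal]
  have hd : diagonal (fun i => ((h.eigenvalues i + ε : ℝ) : ℂ)) =
      diagonal (fun i => (h.eigenvalues i : ℂ)) + (ε : ℂ) • (1 : Matrix ι ι ℂ) := by
    simp [← diagonal_one, ← diagonal_smul, diagonal_add, Pi.smul_def]
  rw [hd, Matrix.mul_add, Matrix.add_mul, Matrix.mul_smul, Matrix.smul_mul, Matrix.mul_one,
    Unitary.mul_star_self_of_mem h.eigenvectorUnitary.2]

theorem trace_mul_unitary_conj_diagonal {τ : Matrix ι ι ℂ} (h : τ.IsHermitian) (f : ι → ℝ) :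
    (τ * ((h.eigenvectorUnitary : Matrix ι ι ℂ) * diagonal (fun i => (f i : ℂ)) *
      star (h.eigenvectorUnitary : Matrix ι ι ℂ))).trace =
      ((∑ i, h.eigenvalues i * f i : ℝ) : ℂ) := by
  conv_lhs => enter [1, 1]; rw [h.eq_unitary_conj_diagonal]
  have hU := Unitary.coe_star_mul_self h.eigenvectorUnitary
  generalize (h.eigenvectorUnitary : Matrix ι ι ℂ) = U at *
  calc _ = (U * (diagonal (fun i => (h.eigenvalues i : ℂ)) * (star U * U) *
        diagonal (fun i => (f i : ℂ)) * star U)).trace := by simp only [Matrix.mul_assoc]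
    _ = _ := by
      rw [hU, Matrix.mul_one, diagonal_mul_diagonal, trace_mul_comm, Matrix.mul_assoc, hU,
        Matrix.mul_one, trace_diagonal]
      simp

theorem trace_mul_matLog {τ : Matrix ι ι ℂ} (h : τ.IsHermitian) :
    (τ * matLog τ).trace.re = ∑ i, h.eigenvalues i * Real.log (h.eigenvalues i) := by
  rw [matLog, dif_pos h, trace_mul_unitary_conj_diagonal, Complex.ofReal_re]

theorem tendsto_trace_mul_matLog_add_smul_one {τ : Matrix ι ι ℂ} (h : τ.IsHermitian) :
    Tendsto (fun ε : ℝ => (τ * matLog (τ + (ε : ℂ) • 1)).trace.re) (𝓝[>] 0)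
      (𝓝 (τ * matLog τ).trace.re) := by
  simp only [matLog_add_smul_one h, trace_mul_unitary_conj_diagonal h, Complex.ofReal_re,
    trace_mul_matLog h]
  refine tendsto_finsetSum _ fun i _ => ?_
  rcases eq_or_ne (h.eigenvalues i) 0 with h0 | h0
  · simp [h0]
  · have hc : ContinuousAt (fun ε : ℝ => h.eigenvalues i * Real.log (h.eigenvalues i + ε)) 0 :=
      continuousAt_const.mul ((Real.continuousAt_log (by simpa using h0)).comp (by fun_prop))
    simpa using hc.tendsto.mono_left nhdsWithin_le_nhds

theorem Matrix.PosSemidef.trace_mul_re_nonneg {A B : Matrix ι ι ℂ} (hA : A.PosSemidef)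
    (hB : B.PosSemidef) : 0 ≤ (A * B).trace.re := by
  obtain ⟨C, rfl⟩ := CStarAlgebra.nonneg_iff_eq_star_mul_self.mp hB.nonneg
  rw [← Matrix.mul_assoc, trace_mul_comm, ← Matrix.mul_assoc]
  exact (Complex.nonneg_iff.mp (hA.mul_mul_conjTranspose_same C).trace_nonneg).1

theorem kronecker_mem_unitaryGroup (U : unitaryGroup ι ℂ) (V : unitaryGroup κ ℂ) :
    (U : Matrix ι ι ℂ) ⊗ₖ (V : Matrix κ κ ℂ) ∈ unitaryGroup (ι × κ) ℂ := by
  rw [mem_unitaryGroup_iff, star_eq_conjTranspose, conjTranspose_kronecker, ← mul_kronecker_mul,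
    ← star_eq_conjTranspose, ← star_eq_conjTranspose, Unitary.mul_star_self_of_mem U.2,
    Unitary.mul_star_self_of_mem V.2, one_kronecker_one]

theorem kronecker_unitary_conj_diagonal (U : Matrix ι ι ℂ) (V : Matrix κ κ ℂ)
    (d : ι → ℂ) (e : κ → ℂ) :
    (U * diagonal d * star U) ⊗ₖ (V * diagonal e * star V) =
      (U ⊗ₖ V) * diagonal (fun x : ι × κ => d x.1 * e x.2) * star (U ⊗ₖ V) := by
  rw [mul_kronecker_mul, mul_kronecker_mul, diagonal_kronecker_diagonal, star_eq_conjTranspose,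
    star_eq_conjTranspose, star_eq_conjTranspose, conjTranspose_kronecker]

theorem matLog_kronecker_one {τ : Matrix ι ι ℂ} (h : τ.IsHermitian) :
    matLog (τ ⊗ₖ (1 : Matrix κ κ ℂ)) = matLog τ ⊗ₖ (1 : Matrix κ κ ℂ) := by
  let W : unitaryGroup (ι × κ) ℂ := ⟨_, kronecker_mem_unitaryGroup h.eigenvectorUnitary 1⟩
  have hone : (1 : Matrix κ κ ℂ) = ((1 : unitaryGroup κ ℂ) : Matrix κ κ ℂ) *
      diagonal (fun _ => (1 : ℂ)) * star ((1 : unitaryGroup κ ℂ) : Matrix κ κ ℂ) := by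
    simp
  have hW := matLog_unitary_conj_diagonal W (fun x => h.eigenvalues x.1)
  rw [matLog.eq_1 τ, dif_pos h]
  conv_lhs => rw [h.eq_unitary_conj_diagonal]
  rw [hone, kronecker_unitary_conj_diagonal, kronecker_unitary_conj_diagonal]
  simpa only [mul_one] using hW

theorem trace_mul_unitary_conj_diagonal_eq_sum (ω W : Matrix ι ι ℂ) (f : ι → ℝ) :
    (ω * (W * diagonal (fun i => (f i : ℂ)) * star W)).trace.re =
      ∑ i, ((star W * ω * W) i i).re * f i := by
  rw [← Matrix.mul_assoc, trace_mul_comm, ← Matrix.mul_assoc, ← Matrix.mul_assoc, trace]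
  simp [mul_diagonal, Complex.re_sum]

theorem sum_diag_conj_kronecker_mul_fst {ω : Matrix (ι × κ) (ι × κ) ℂ}
    (h : (ptrace2 ω).IsHermitian) (V : unitaryGroup κ ℂ) (f : ι → ℝ) :
    ∑ x, ((star ((h.eigenvectorUnitary : Matrix ι ι ℂ) ⊗ₖ (V : Matrix κ κ ℂ)) * ω *
      ((h.eigenvectorUnitary : Matrix ι ι ℂ) ⊗ₖ (V : Matrix κ κ ℂ))) x x).re * f x.1 =
      ∑ i, h.eigenvalues i * f i := by
  have hone : (1 : Matrix κ κ ℂ) = (V : Matrix κ κ ℂ) *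
      diagonal (fun _ => (1 : ℂ)) * star (V : Matrix κ κ ℂ) := by
    rw [diagonal_one, Matrix.mul_one, Unitary.mul_star_self_of_mem V.2]
  have := trace_mul_unitary_conj_diagonal h f
  rw [← trace_mul_kronecker_one, hone, kronecker_unitary_conj_diagonal] at this
  simp only [mul_one] at this
  rw [← trace_mul_unitary_conj_diagonal_eq_sum ω _ (fun x => f x.1), this, Complex.ofReal_re]

theorem sum_diag_conj_kronecker_mul_snd {ω : Matrix (ι × κ) (ι × κ) ℂ}
    (h : (ptrace1 ω).IsHermitian) (U : unitaryGroup ι ℂ) (f : κ → ℝ) :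
    ∑ x, ((star ((U : Matrix ι ι ℂ) ⊗ₖ (h.eigenvectorUnitary : Matrix κ κ ℂ)) * ω *
      ((U : Matrix ι ι ℂ) ⊗ₖ (h.eigenvectorUnitary : Matrix κ κ ℂ))) x x).re * f x.2 =
      ∑ j, h.eigenvalues j * f j := by
  have hone : (1 : Matrix ι ι ℂ) = (U : Matrix ι ι ℂ) *
      diagonal (fun _ => (1 : ℂ)) * star (U : Matrix ι ι ℂ) := by
    rw [diagonal_one, Matrix.mul_one, Unitary.mul_star_self_of_mem U.2]
  have := trace_mul_unitary_conj_diagonal h f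
  rw [← trace_mul_one_kronecker, hone, kronecker_unitary_conj_diagonal] at this
  simp only [one_mul] at this
  rw [← trace_mul_unitary_conj_diagonal_eq_sum ω _ (fun x => f x.2), this, Complex.ofReal_re]

theorem matLog_kronecker {ρ : Matrix ι ι ℂ} {σ : Matrix κ κ ℂ} (hρ : ρ.IsHermitian)
    (hσ : σ.IsHermitian) :
    matLog (ρ ⊗ₖ σ) =
      ((hρ.eigenvectorUnitary : Matrix ι ι ℂ) ⊗ₖ (hσ.eigenvectorUnitary : Matrix κ κ ℂ)) *
      diagonal (fun x => (Real.log (hρ.eigenvalues x.1 * hσ.eigenvalues x.2) : ℂ)) *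
      star ((hρ.eigenvectorUnitary : Matrix ι ι ℂ) ⊗ₖ
        (hσ.eigenvectorUnitary : Matrix κ κ ℂ)) := by
  have h := matLog_unitary_conj_diagonal
    ⟨_, kronecker_mem_unitaryGroup hρ.eigenvectorUnitary hσ.eigenvectorUnitary⟩
    (fun x => hρ.eigenvalues x.1 * hσ.eigenvalues x.2)
  rw [← h]
  conv_lhs => rw [hρ.eq_unitary_conj_diagonal, hσ.eq_unitary_conj_diagonal]
  simp only [kronecker_unitary_conj_diagonal, Complex.ofReal_mul]

theorem trace_mul_matLog_kronecker_marginals {ω : Matrix (ι × κ) (ι × κ) ℂ}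
    (h : ω.PosSemidef) :
    (ω * matLog (ptrace2 ω ⊗ₖ ptrace1 ω)).trace.re =
      (ptrace2 ω * matLog (ptrace2 ω)).trace.re + (ptrace1 ω * matLog (ptrace1 ω)).trace.re := by
  have hr := ptrace2_isHermitian h.1
  have hs := ptrace1_isHermitian h.1
  rw [matLog_kronecker hr hs, trace_mul_unitary_conj_diagonal_eq_sum, trace_mul_matLog hr,
    trace_mul_matLog hs]
  exact sum_mul_log_mul_of_marginals
    (fun _ => (Complex.nonneg_iff.mp (h.conjTranspose_mul_mul_same _).diag_nonneg).1)
    (sum_diag_conj_kronecker_mul_fst hr _) (sum_diag_conj_kronecker_mul_snd hs _)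

theorem mutualInfo_eq_vnEntropy_add_sub {ω : Matrix (ι × κ) (ι × κ) ℂ} (h : ω.PosSemidef) :
    mutualInfo ω = vnEntropy (ptrace2 ω) + vnEntropy (ptrace1 ω) - vnEntropy ω := by
  rw [mutualInfo, relEntropy, Matrix.mul_sub, trace_sub, Complex.sub_re,
    trace_mul_matLog_kronecker_marginals h]
  simp only [vnEntropy]
  ring

/-- Operator monotonicity of the logarithm, applied to `ω + ε ≤ (ρ + ε) ⊗ 1`. -/
theorem vnEntropy_ptrace2_le_of_le_kronecker_one {ω : Matrix (ι × κ) (ι × κ) ℂ}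
    (h : ω.PosSemidef) (hle : ω ≤ ptrace2 ω ⊗ₖ (1 : Matrix κ κ ℂ)) :
    vnEntropy (ptrace2 ω) ≤ vnEntropy ω := by
  have hr := ptrace2_isHermitian h.1
  refine neg_le_neg (le_of_tendsto_of_tendsto (tendsto_trace_mul_matLog_add_smul_one h.1)
    (tendsto_trace_mul_matLog_add_smul_one hr) ?_)
  filter_upwards [self_mem_nhdsWithin] with ε hε
  have hε' : (0 : ℂ) < ε := by exact_mod_cast Set.mem_Ioi.mp hε
  have hadd : (ptrace2 ω + (ε : ℂ) • 1) ⊗ₖ (1 : Matrix κ κ ℂ) =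
      ptrace2 ω ⊗ₖ (1 : Matrix κ κ ℂ) + (ε : ℂ) • 1 := by
    rw [add_kronecker, smul_kronecker, one_kronecker_one]
  have hpos : (ω + (ε : ℂ) • 1).PosDef := PosDef.posSemidef_add h (PosDef.one.smul hε')
  have hmono : ω + (ε : ℂ) • 1 ≤ (ptrace2 ω + (ε : ℂ) • 1) ⊗ₖ (1 : Matrix κ κ ℂ) := by
    rw [hadd]
    exact add_le_add_left hle _
  have hrε : (ptrace2 ω + (ε : ℂ) • 1).IsHermitian :=
    hr.add (PosDef.one.smul hε').1
  have hlog := CFC.log_le_log hmono hpos.isStrictlyPositive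
  have hh : ((ptrace2 ω + (ε : ℂ) • 1) ⊗ₖ (1 : Matrix κ κ ℂ)).IsHermitian := by
    rw [IsHermitian, conjTranspose_kronecker, hrε.eq, conjTranspose_one]
  rw [← matLog_eq_cfcLog hpos.1, ← matLog_eq_cfcLog hh, matLog_kronecker_one hrε] at hlog
  have := h.trace_mul_re_nonneg (Matrix.le_iff.mp hlog)
  rw [Matrix.mul_sub, trace_sub, Complex.sub_re, trace_mul_kronecker_one] at this
  exact sub_nonneg.mp this

theorem IsDensity.le_one {σ : Matrix ι ι ℂ} (h : IsDensity σ) : σ ≤ 1 := by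
  have hH := h.1.1
  have hsum : ∑ i, hH.eigenvalues i = 1 := by
    have := hH.trace_eq_sum_eigenvalues
    rw [h.2] at this
    simpa using (congrArg Complex.re this).symm
  have heig (i) : hH.eigenvalues i ≤ 1 :=
    hsum ▸ Finset.single_le_sum (fun j _ => h.1.eigenvalues_nonneg j) (Finset.mem_univ i)
  have hd : (diagonal (fun i => ((1 - hH.eigenvalues i : ℝ) : ℂ))).PosSemidef :=
    PosSemidef.diagonal fun i => by
      simpa only [Pi.zero_apply, Complex.zero_le_real, sub_nonneg] using heig i
  have := hd.mul_mul_conjTranspose_same (hH.eigenvectorUnitary : Matrix ι ι ℂ)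
  rw [Matrix.le_iff]
  have hdiag : diagonal (fun i => ((1 - hH.eigenvalues i : ℝ) : ℂ)) =
      1 - diagonal (fun i => (hH.eigenvalues i : ℂ)) := by
    simp [← diagonal_one, diagonal_sub]
  rwa [hdiag, Matrix.mul_sub, Matrix.sub_mul, Matrix.mul_one, ← star_eq_conjTranspose,
    Unitary.mul_star_self_of_mem hH.eigenvectorUnitary.2, ← hH.eq_unitary_conj_diagonal] at this

end

theorem separable_mutualInfo_le_marginal_entropy {m n k : ℕ}
    (p : Fin k → ℝ) (hp0 : ∀ i, 0 ≤ p i) (hp1 : ∑ i, p i = 1)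
    (ρs : Fin k → Matrix (Fin m) (Fin m) ℂ) (σs : Fin k → Matrix (Fin n) (Fin n) ℂ)
    (hρ : ∀ i, IsDensity (ρs i)) (hσ : ∀ i, IsDensity (σs i)) :
    mutualInfo (∑ i, (p i : ℂ) • ((ρs i) ⊗ₖ (σs i)))
      ≤ vnEntropy (∑ i, (p i : ℂ) • σs i) := by
  have hp (i) : (0 : ℂ) ≤ p i := by exact_mod_cast hp0 i
  have hpos : (∑ i, (p i : ℂ) • ((ρs i) ⊗ₖ (σs i))).PosSemidef :=
    posSemidef_sum _ fun i _ => ((hρ i).1.kronecker (hσ i).1).smul (hp i)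
  have h2 := ptrace2_sum_smul_kronecker (fun i => (p i : ℂ)) ρs σs fun i => (hσ i).2
  have h1 := ptrace1_sum_smul_kronecker (fun i => (p i : ℂ)) ρs σs fun i => (hρ i).2
  have hle : (∑ i, (p i : ℂ) • ((ρs i) ⊗ₖ (σs i))) ≤
      ptrace2 (∑ i, (p i : ℂ) • ((ρs i) ⊗ₖ (σs i))) ⊗ₖ (1 : Matrix (Fin n) (Fin n) ℂ) := by
    have hdiff : ptrace2 (∑ i, (p i : ℂ) • ((ρs i) ⊗ₖ (σs i))) ⊗ₖ (1 : Matrix (Fin n) (Fin n) ℂ) -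
        (∑ i, (p i : ℂ) • ((ρs i) ⊗ₖ (σs i))) = ∑ i, (p i : ℂ) • (ρs i ⊗ₖ (1 - σs i)) := by
      rw [h2]
      ext ⟨a, b⟩ ⟨c, d⟩
      rw [Matrix.sub_apply, kronecker_apply, Matrix.sum_apply, Matrix.sum_apply, Matrix.sum_apply,
        Finset.sum_mul, ← Finset.sum_sub_distrib]
      refine Finset.sum_congr rfl fun i _ => ?_
      simp only [kronecker_apply, Matrix.smul_apply, Matrix.sub_apply, smul_eq_mul]
      ring
    rw [Matrix.le_iff, hdiff]
    exact posSemidef_sum _ fun i _ =>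
      ((hρ i).1.kronecker (Matrix.le_iff.mp (hσ i).le_one)).smul (hp i)
  have hS := vnEntropy_ptrace2_le_of_le_kronecker_one hpos hle
  rw [mutualInfo_eq_vnEntropy_add_sub hpos, h1]
  linarith
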